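/- arXiv:math/0409487 — 2 statements merged into one kernel-verified Lean document; each statement's English description precedes it below -/
import Mathlib

section
/- Let 𝔤 be a finite-dimensional Lie algebra over ℂ, let N be a simple 𝔤-module, and let x ∈ 𝔤. Then either x acts locally finitely on N (for every v ∈ N the span of {v, x·v, x²·v, …} is finite-dimensional), or x acts freely on N (for every nonzero v ∈ N the vectors v, x·v, x²·v, … are linearly independent). -/
open Polynomial in
/-- If a nonzero polynomial in `f` kills `v`, then `v` lies in a finite-dimensional
`f`-invariant subspace. -/
theorem exists_fg_invariant_of_aeval_apply_eq_zero {K V : Type*} [Field K] [AddCommGroup V]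
    [Module K V] (f : Module.End K V) (v : V) {p : K[X]} (hp : p ≠ 0) (h : aeval f p v = 0) :
    ∃ W : Submodule K V, W.FG ∧ W ≤ W.comap f ∧ v ∈ W := by
  let φ : K[X] →ₗ[K] V := (LinearMap.applyₗ v).comp (aeval f).toLinearMap
  have hφ (q : K[X]) : φ q = aeval f q v := rfl
  have hmod (q : K[X]) : φ (q % p) = φ q := by
    conv_rhs => rw [← EuclideanDomain.mod_add_div q p, mul_comm p]
    simp [hφ, h]
  refine ⟨LinearMap.range φ, ?_, ?_, 1, by simp [hφ]⟩
  · have : LinearMap.range φ = (degreeLT K p.natDegree).map φ := by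
      refine le_antisymm ?_ LinearMap.map_le_range
      rintro _ ⟨q, rfl⟩
      refine ⟨q % p, mem_degreeLT.2 ?_, hmod q⟩
      rw [← degree_eq_natDegree hp]
      exact EuclideanDomain.mod_lt q hp
    rw [this]
    have : FiniteDimensional K (degreeLT K p.natDegree) :=
      (degreeLTEquiv K p.natDegree).symm.finiteDimensional
    exact (Module.Finite.iff_fg.1 this).map φ
  · rintro _ ⟨q, rfl⟩
    exact ⟨X * q, by simp [hφ]⟩

/-- The vectors contained in a finite-dimensional subspace invariant under `x` form a Lie
submodule. -/
def locallyFiniteLieSubmodule (K L V : Type*) [Field K] [LieRing L] [LieAlgebra K L]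
    [FiniteDimensional K L] [AddCommGroup V] [Module K V] [LieRingModule L V] [LieModule K L V]
    (x : L) : LieSubmodule K L V where
  carrier := {v | ∃ W : Submodule K V, W.FG ∧ W ≤ W.comap (LieModule.toEnd K L V x) ∧ v ∈ W}
  zero_mem' := ⟨⊥, Submodule.fg_bot, bot_le, zero_mem _⟩
  add_mem' := by
    rintro v w ⟨W, hW, hxW, hv⟩ ⟨W', hW', hxW', hw⟩
    refine ⟨W ⊔ W', hW.sup hW', sup_le ?_ ?_, Submodule.add_mem_sup hv hw⟩
    · exact hxW.trans (Submodule.comap_mono le_sup_left)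
    · exact hxW'.trans (Submodule.comap_mono le_sup_right)
  smul_mem' := by
    rintro c v ⟨W, hW, hxW, hv⟩
    exact ⟨W, hW, hxW, W.smul_mem c hv⟩
  lie_mem := by
    rintro y v ⟨W, hW, hxW, hv⟩
    refine ⟨Submodule.map₂ (LieModule.toEnd K L V : L →ₗ[K] Module.End K V) ⊤ W,
      (Module.Finite.fg_top (R := K) (M := L)).map₂ _ hW, ?_, ?_⟩
    · refine Submodule.map₂_le.2 fun z _ w hw => ?_
      simp only [Submodule.mem_comap, LieHom.coe_toLinearMap, LieModule.toEnd_apply_apply,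
        leibniz_lie x z w]
      exact Submodule.add_mem _ (Submodule.apply_mem_map₂ _ trivial hw)
        (Submodule.apply_mem_map₂ _ trivial (hxW hw))
    · exact Submodule.apply_mem_map₂ (LieModule.toEnd K L V : L →ₗ[K] Module.End K V)
        trivial hv


/-- On a simple module `N` over a finite-dimensional complex Lie algebra `g`, any `x ∈ g`
acts either locally finitely (the span of `{xⁿ·v}` is finite-dimensional for every `v`)
or freely (the vectors `v, x·v, x²·v, …` are linearly independent for every `v ≠ 0`). -/
theorem stmt3 (g : Type*) [LieRing g] [LieAlgebra ℂ g] [FiniteDimensional ℂ g]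
    (N : Type*) [AddCommGroup N] [Module ℂ N] [LieRingModule g N] [LieModule ℂ g N]
    [LieModule.IsIrreducible ℂ g N] (x : g) :
    (∀ v : N, FiniteDimensional ℂ
        (Submodule.span ℂ (Set.range fun n : ℕ => ((LieModule.toEnd ℂ g N x) ^ n) v))) ∨
    (∀ v : N, v ≠ 0 →
        LinearIndependent ℂ (fun n : ℕ => ((LieModule.toEnd ℂ g N x) ^ n) v)) := by
  rcases eq_bot_or_eq_top (locallyFiniteLieSubmodule ℂ g N x) with h | h
  · refine Or.inr fun v hv => (Polynomial.linearIndependent_powers_iff_aeval _ v).2 fun p hp => ?_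
    by_contra hp0
    have hmem : v ∈ locallyFiniteLieSubmodule ℂ g N x :=
      exists_fg_invariant_of_aeval_apply_eq_zero _ v hp0 hp
    rw [h] at hmem
    exact hv ((LieSubmodule.mem_bot v).1 hmem)
  · refine Or.inl fun v => ?_
    have hmem : v ∈ locallyFiniteLieSubmodule ℂ g N x := h ▸ LieSubmodule.mem_top v
    obtain ⟨W, hW, hxW, hv⟩ := hmem
    have : FiniteDimensional ℂ W := Module.Finite.iff_fg.2 hW
    refine Submodule.finiteDimensional_of_le (S₂ := W) (Submodule.span_le.2 ?_)
    rintro _ ⟨n, rfl⟩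
    exact Module.End.pow_apply_mem_of_forall_mem n hxW v hv
end

section
/- Let 𝔤 be a finite-dimensional Lie algebra over ℂ, let N be a 𝔤-module, and let x ∈ 𝔤. Then the set {v ∈ N | the span of {v, x·v, x²·v, …} is finite-dimensional} of vectors on which x acts locally finitely is a 𝔤-submodule of N. -/
/-- The iterates of `v` under `f` span a finite-dimensional subspace iff `v` lies in some
finite-dimensional `f`-stable subspace. -/
theorem finiteDimensional_span_range_pow_apply_iff {K V : Type*} [Field K] [AddCommGroup V]
    [Module K V] (f : Module.End K V) (v : V) :
    FiniteDimensional K (Submodule.span K (Set.range fun n : ℕ => (f ^ n) v)) ↔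
      ∃ W : Submodule K V, W.FG ∧ W ≤ W.comap f ∧ v ∈ W := by
  constructor
  · intro h
    refine ⟨_, Module.Finite.iff_fg.mp h, ?_, Submodule.subset_span ⟨0, by simp⟩⟩
    rw [Submodule.span_le]
    rintro _ ⟨n, rfl⟩
    exact Submodule.subset_span ⟨n + 1, by simp [pow_succ']⟩
  · rintro ⟨W, hfg, hW, hv⟩
    have : FiniteDimensional K W := Module.Finite.iff_fg.mpr hfg
    refine Submodule.finiteDimensional_of_le (S₂ := W) (Submodule.span_le.mpr ?_)
    rintro _ ⟨n, rfl⟩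
    induction n with
    | zero => simpa using hv
    | succ n ih => simpa [pow_succ'] using hW ih

/-- For a finite-dimensional complex Lie algebra `g`, a `g`-module `N` and `x ∈ g`,
the set of vectors of `N` on which `x` acts locally finitely is a `g`-submodule of `N`. -/
theorem stmt4 (g : Type*) [LieRing g] [LieAlgebra ℂ g] [FiniteDimensional ℂ g]
    (N : Type*) [AddCommGroup N] [Module ℂ N] [LieRingModule g N] [LieModule ℂ g N]
    (x : g) :
    ∃ S : LieSubmodule ℂ g N, (S : Set N) =
      {v : N | FiniteDimensional ℂ
        (Submodule.span ℂ (Set.range fun n : ℕ => ((LieModule.toEnd ℂ g N x) ^ n) v))} := by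
  simp only [finiteDimensional_span_range_pow_apply_iff]
  refine ⟨{ carrier := _, add_mem' := ?_, zero_mem' := ?_, smul_mem' := ?_, lie_mem := ?_ }, rfl⟩
  · rintro a b ⟨U, hU, hUx, ha⟩ ⟨W, hW, hWx, hb⟩
    exact ⟨U ⊔ W, hU.sup hW, sup_le (hUx.trans (Submodule.comap_mono le_sup_left))
      (hWx.trans (Submodule.comap_mono le_sup_right)), Submodule.add_mem_sup ha hb⟩
  · exact ⟨⊥, Submodule.fg_bot, bot_le, Submodule.zero_mem _⟩
  · rintro c v ⟨W, hW, hWx, hv⟩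
    exact ⟨W, hW, hWx, W.smul_mem c hv⟩
  · rintro y v ⟨W, hW, hWx, hv⟩
    let φ : g →ₗ[ℂ] N →ₗ[ℂ] N := (LieModule.toEnd ℂ g N : g →ₗ[ℂ] Module.End ℂ N)
    refine ⟨Submodule.map₂ φ ⊤ W, Submodule.FG.map₂ φ Module.Finite.fg_top hW, ?_,
      Submodule.apply_mem_map₂ φ Submodule.mem_top hv⟩
    rw [Submodule.map₂_le]
    intro z _ w hw
    change ⁅x, ⁅z, w⁆⁆ ∈ Submodule.map₂ φ ⊤ W
    rw [leibniz_lie]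
    exact add_mem (Submodule.apply_mem_map₂ φ (m := ⁅x, z⁆) Submodule.mem_top hw)
      (Submodule.apply_mem_map₂ φ (m := z) Submodule.mem_top (hWx hw))
end
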